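/- With the above data, there exist a non-decreasing function κ : [0, ∞) → [0, a) and a non-increasing function ρ : [0, ∞) → (L, λ] such that for every w ∈ Ω and every i = 1,…,n, writing S_i := Σ_{j≠i} V'(d_{i,j})(x_i − x_j)/d_{i,j}: (i) k_i(w) v* ≥ S_i ≥ −k_i(w)(v_max cos θ_i − v*); (ii) μ₂ ≤ k_i(w) ≤ R(H(w)), where R(s) := μ₂ + (m/v*) b₁(ρ(s)) + v_max (A + s cos φ (1 − cos φ)) · max{f(z) : |z| ≤ m b₁(ρ(s))} / (A v* (v_max − v*) + v* (v_max cos φ − v*)(1 − cos φ) s) and b₁(s) := max{|V'(d)| : s ≤ d ≤ λ}; (iii) k_i(w) v_max ≥ k_i(w)(v_max − v_i) ≥ F_i(w) ≥ −k_i(w) v_i ≥ −k_i(w) v_max; and (iv) |u_i(w)| ≤ (1/v*)((μ₁ + k_i(w)) v_max + b₂(κ(H(w))) + m √p b₁(ρ(H(w)))), where b₂(s) := max{|U'(y)| : |y| ≤ s}. -/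

import Mathlib

open Real Set Filter

noncomputable def dE (p : ℝ) {n : ℕ} (x y : Fin n → ℝ) (i j : Fin n) : ℝ :=
  Real.sqrt ((x i - x j)^2 + p * (y i - y j)^2)

noncomputable def Hfun (p vstar φ A : ℝ) (U V : ℝ → ℝ) {n : ℕ}
    (x y θ v : Fin n → ℝ) : ℝ :=
  (1/2) * ∑ i, (v i * Real.cos (θ i) - vstar)^2
  + (1/2) * ∑ i, (v i)^2 * (Real.sin (θ i))^2
  + ∑ i, U (y i)
  + (1/2) * ∑ i, ∑ j ∈ Finset.univ.erase i, V (dE p x y i j)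
  + A * ∑ i, (1/(Real.cos (θ i) - Real.cos φ) - 1/(1 - Real.cos φ))

def inOmega (a L p vmax φ : ℝ) {n : ℕ} (x y θ v : Fin n → ℝ) : Prop :=
  (∀ i, y i ∈ Set.Ioo (-a) a) ∧ (∀ i, θ i ∈ Set.Ioo (-φ) φ) ∧
  (∀ i, v i ∈ Set.Ioo 0 vmax) ∧ (∀ i j, i ≠ j → L < dE p x y i j)

noncomputable def Sx (p : ℝ) (V : ℝ → ℝ) {n : ℕ} (x y : Fin n → ℝ) (i : Fin n) : ℝ :=
  ∑ j ∈ Finset.univ.erase i, deriv V (dE p x y i j) * (x i - x j) / dE p x y i j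

noncomputable def Sy (p : ℝ) (V : ℝ → ℝ) {n : ℕ} (x y : Fin n → ℝ) (i : Fin n) : ℝ :=
  ∑ j ∈ Finset.univ.erase i, deriv V (dE p x y i j) * (y i - y j) / dE p x y i j

noncomputable def kGain (p vmax vstar μ₂ : ℝ) (f V : ℝ → ℝ) {n : ℕ}
    (x y θ : Fin n → ℝ) (i : Fin n) : ℝ :=
  μ₂ + (1/vstar) * Sx p V x y i
    + (vmax * Real.cos (θ i)) / (vstar * (vmax * Real.cos (θ i) - vstar))
      * f (-(Sx p V x y i))

noncomputable def Fctrl (p vmax vstar μ₂ : ℝ) (f V : ℝ → ℝ) {n : ℕ}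
    (x y θ v : Fin n → ℝ) (i : Fin n) : ℝ :=
  -(kGain p vmax vstar μ₂ f V x y θ i / Real.cos (θ i)) * (v i * Real.cos (θ i) - vstar)
    - (1 / Real.cos (θ i)) * Sx p V x y i

noncomputable def uctrl (p vmax vstar φ A μ₁ μ₂ : ℝ) (f U V : ℝ → ℝ) {n : ℕ}
    (x y θ v : Fin n → ℝ) (i : Fin n) : ℝ :=
  -(vstar + A / (v i * (Real.cos (θ i) - Real.cos φ)^2))⁻¹ *
    (μ₁ * v i * Real.sin (θ i) + deriv U (y i) + p * Sy p V x y i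
      + Real.sin (θ i) * Fctrl p vmax vstar μ₂ f V x y θ v i)

noncomputable def b1 (lam : ℝ) (V : ℝ → ℝ) (s : ℝ) : ℝ :=
  sSup ((fun d => |deriv V d|) '' Set.Icc s lam)

noncomputable def b2 (U : ℝ → ℝ) (s : ℝ) : ℝ :=
  sSup ((fun z => |deriv U z|) '' Set.Icc (-s) s)

noncomputable def Rfun (lam vmax vstar φ A μ₂ : ℝ) (m : ℕ) (f V : ℝ → ℝ)
    (ρ : ℝ → ℝ) (s : ℝ) : ℝ :=
  μ₂ + (m / vstar) * b1 lam V (ρ s)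
    + vmax * (A + s * Real.cos φ * (1 - Real.cos φ))
        * sSup (f '' Set.Icc (-(m * b1 lam V (ρ s))) (m * b1 lam V (ρ s)))
      / (A * vstar * (vmax - vstar)
          + vstar * (vmax * Real.cos φ - vstar) * (1 - Real.cos φ) * s)

/-- The interaction count: at most `m` neighbours lie within distance `lam`. -/
lemma card_nbr {n : ℕ} (L lam p : ℝ) (hL : 0 < L) (m : ℕ)
    (hmmax : IsGreatest {k : ℕ | ∃ S : Finset (ℝ × ℝ), S.card = k ∧
      (∀ z ∈ S, L ≤ Real.sqrt (z.1^2 + p * z.2^2) ∧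
        Real.sqrt (z.1^2 + p * z.2^2) ≤ lam) ∧
      (∀ z ∈ S, ∀ z' ∈ S, z ≠ z' →
        L ≤ Real.sqrt ((z.1 - z'.1)^2 + p * (z.2 - z'.2)^2))} m)
    (x y : Fin n → ℝ) (hd : ∀ i j, i ≠ j → L < dE p x y i j) (i : Fin n) :
    ((Finset.univ.erase i).filter (fun j => dE p x y i j ≤ lam)).card ≤ m := by
  classical
  set T := (Finset.univ.erase i).filter (fun j => dE p x y i j ≤ lam) with hT
  let g : Fin n → ℝ × ℝ := fun j => (x i - x j, y i - y j)
  have hinj : Function.Injective g := by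
    intro j k hjk
    by_contra hne
    have h := hd j k hne
    simp only [g, Prod.mk.injEq] at hjk
    have h1 : x j - x k = 0 := by linarith [hjk.1]
    have h2 : y j - y k = 0 := by linarith [hjk.2]
    simp [dE, h1, h2] at h
    linarith
  have hc : (T.image g).card = T.card := Finset.card_image_of_injective _ hinj
  rw [← hc]
  apply hmmax.2
  refine ⟨T.image g, rfl, ?_, ?_⟩
  · intro z hz
    obtain ⟨j, hj, rfl⟩ := Finset.mem_image.1 hz
    rw [hT, Finset.mem_filter, Finset.mem_erase] at hj
    exact ⟨(hd i j (Ne.symm hj.1.1)).le, hj.2⟩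
  · intro z hz z' hz' hne
    obtain ⟨j, hj, rfl⟩ := Finset.mem_image.1 hz
    obtain ⟨k, hk, rfl⟩ := Finset.mem_image.1 hz'
    have hjk : k ≠ j := by rintro rfl; exact hne rfl
    have h := (hd k j hjk).le
    simp only [dE] at h
    show L ≤ Real.sqrt (((x i - x j) - (x i - x k))^2 + p * ((y i - y j) - (y i - y k))^2)
    rw [show (x i - x j) - (x i - x k) = x k - x j by ring,
      show (y i - y j) - (y i - y k) = y k - y j by ring]
    exact h

lemma deriv_zero_far (lam : ℝ) (V : ℝ → ℝ) (hV0 : ∀ d, lam ≤ d → V d = 0) (d : ℝ)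
    (hd : lam < d) : deriv V d = 0 := by
  have h : V =ᶠ[nhds d] fun _ => (0:ℝ) := by
    filter_upwards [Ioi_mem_nhds hd] with z hz
    exact hV0 z (le_of_lt hz)
  rw [h.deriv_eq]; simp

lemma le_b1 (L lam : ℝ) (V : ℝ → ℝ) (hV : ContDiffOn ℝ 2 V (Set.Ioi L)) (s d : ℝ)
    (hs : L < s) (hd : d ∈ Set.Icc s lam) : |deriv V d| ≤ b1 lam V s := by
  apply le_csSup
  · apply IsCompact.bddAbove
    apply isCompact_Icc.image_of_continuousOn
    apply ContinuousOn.abs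
    exact (hV.continuousOn_deriv_of_isOpen isOpen_Ioi (by norm_num)).mono
      (fun z hz => lt_of_lt_of_le hs hz.1)
  · exact ⟨d, hd, rfl⟩

lemma b1_nonneg (lam : ℝ) (V : ℝ → ℝ) (s : ℝ) : 0 ≤ b1 lam V s := by
  apply Real.sSup_nonneg
  rintro _ ⟨z, _, rfl⟩
  exact abs_nonneg _

lemma le_b2 (a : ℝ) (U : ℝ → ℝ) (hU : ContDiffOn ℝ 2 U (Set.Ioo (-a) a)) (s d : ℝ)
    (hs : s < a) (hd : d ∈ Set.Icc (-s) s) : |deriv U d| ≤ b2 U s := by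
  apply le_csSup
  · apply IsCompact.bddAbove
    apply isCompact_Icc.image_of_continuousOn
    apply ContinuousOn.abs
    exact (hU.continuousOn_deriv_of_isOpen isOpen_Ioo (by norm_num)).mono
      (fun z hz => ⟨by linarith [hz.1], lt_of_le_of_lt hz.2 hs⟩)
  · exact ⟨d, hd, rfl⟩

lemma exists_rho (L lam : ℝ) (hlam : L < lam) (V : ℝ → ℝ)
    (hVlim : Filter.Tendsto V (nhdsWithin L (Set.Ioi L)) Filter.atTop)
    (hV0 : ∀ d, lam ≤ d → V d = 0) :
    ∃ ρ : ℝ → ℝ, AntitoneOn ρ (Set.Ici 0) ∧ (∀ s, 0 ≤ s → ρ s ∈ Set.Ioc L lam) ∧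
      ∀ s d, L < d → d ≤ lam → V d ≤ s → ρ s ≤ d := by
  let E : ℝ → Set ℝ := fun s => {d | L < d ∧ d ≤ lam ∧ V d ≤ s}
  have hbd : ∀ s, BddBelow (E s) := fun s => ⟨L, fun d hd => hd.1.le⟩
  have hmem : ∀ s, 0 ≤ s → lam ∈ E s := fun s hs =>
    ⟨hlam, le_refl _, by rw [hV0 lam le_rfl]; exact hs⟩
  refine ⟨fun s => sInf (E s), ?_, ?_, ?_⟩
  · intro s hs t ht hst
    exact csInf_le_csInf (hbd t) ⟨lam, hmem s hs⟩
      (fun d hd => ⟨hd.1, hd.2.1, hd.2.2.trans hst⟩)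
  · intro s hs
    refine ⟨?_, csInf_le (hbd s) (hmem s hs)⟩
    have h := hVlim.eventually (Filter.eventually_gt_atTop s)
    obtain ⟨u, hu, hsub⟩ := mem_nhdsGT_iff_exists_Ioo_subset.1 h
    refine lt_of_lt_of_le hu (le_csInf ⟨lam, hmem s hs⟩ ?_)
    intro d hd
    by_contra hlt
    have : s < V d := hsub ⟨hd.1, not_le.1 hlt⟩
    linarith [hd.2.2]
  · intro s d h1 h2 h3
    exact csInf_le (hbd s) ⟨h1, h2, h3⟩

lemma exists_kappa (a : ℝ) (ha : 0 < a) (U : ℝ → ℝ)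
    (hUlim1 : Filter.Tendsto U (nhdsWithin (-a) (Set.Ioi (-a))) Filter.atTop)
    (hUlim2 : Filter.Tendsto U (nhdsWithin a (Set.Iio a)) Filter.atTop)
    (hU0 : U 0 = 0) :
    ∃ κ : ℝ → ℝ, MonotoneOn κ (Set.Ici 0) ∧ (∀ s, 0 ≤ s → κ s ∈ Set.Ico 0 a) ∧
      ∀ s y, y ∈ Set.Ioo (-a) a → U y ≤ s → |y| ≤ κ s := by
  let E : ℝ → Set ℝ := fun s => {r | ∃ y ∈ Set.Ioo (-a) a, U y ≤ s ∧ |y| = r}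
  have hbd : ∀ s, BddAbove (E s) := fun s => ⟨a, by
    rintro r ⟨y, hy, -, rfl⟩
    exact (abs_lt.2 hy).le⟩
  have hmem : ∀ s, 0 ≤ s → (0:ℝ) ∈ E s := fun s hs =>
    ⟨0, ⟨by linarith, ha⟩, by rw [hU0]; exact hs, abs_zero⟩
  refine ⟨fun s => sSup (E s), ?_, ?_, ?_⟩
  · intro s hs t ht hst
    apply csSup_le_csSup (hbd t) ⟨0, hmem s hs⟩
    rintro r ⟨y, hy, h, rfl⟩
    exact ⟨y, hy, h.trans hst, rfl⟩
  · intro s hs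
    refine ⟨le_csSup (hbd s) (hmem s hs), ?_⟩
    obtain ⟨u, hu, hsub⟩ := mem_nhdsGT_iff_exists_Ioo_subset.1
      (hUlim1.eventually (Filter.eventually_gt_atTop s))
    obtain ⟨l, hl, hsub2⟩ := mem_nhdsLT_iff_exists_Ioo_subset.1
      (hUlim2.eventually (Filter.eventually_gt_atTop s))
    have hu' : -a < u := hu
    have hl' : l < a := hl
    refine lt_of_le_of_lt (b := max (-u) l) (csSup_le ⟨0, hmem s hs⟩ ?_)
      (max_lt (by linarith) hl')
    rintro r ⟨y, hy, h, rfl⟩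
    have h1 : u ≤ y := by
      by_contra hlt
      have : s < U y := hsub ⟨hy.1, not_le.1 hlt⟩
      linarith
    have h2 : y ≤ l := by
      by_contra hlt
      have : s < U y := hsub2 ⟨not_le.1 hlt, hy.2⟩
      linarith
    exact abs_le'.2 ⟨h2.trans (le_max_right _ _), by linarith [le_max_left (-u) l]⟩
  · intro s y hy h
    exact le_csSup (hbd s) ⟨y, hy, h, rfl⟩

/-- Weighted interaction sum bound. -/
lemma sum_bound {n : ℕ} (L lam p : ℝ) (hL : 0 < L) (m : ℕ)
    (V : ℝ → ℝ) (hV0 : ∀ d, lam ≤ d → V d = 0)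
    (x y : Fin n → ℝ) (hd : ∀ i j, i ≠ j → L < dE p x y i j) (i : Fin n)
    (hcard : ((Finset.univ.erase i).filter (fun j => dE p x y i j ≤ lam)).card ≤ m)
    (B c : ℝ) (hB : 0 ≤ B) (hc : 0 ≤ c)
    (hVB : ∀ j, i ≠ j → dE p x y i j ≤ lam → |deriv V (dE p x y i j)| ≤ B)
    (g : Fin n → ℝ) (hg : ∀ j, |g j| ≤ c * dE p x y i j) :
    |∑ j ∈ Finset.univ.erase i, deriv V (dE p x y i j) * g j / dE p x y i j|
      ≤ m * (c * B) := by
  classical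
  have h1 : ∑ j ∈ Finset.univ.erase i, deriv V (dE p x y i j) * g j / dE p x y i j
      = ∑ j ∈ (Finset.univ.erase i).filter (fun j => dE p x y i j ≤ lam),
        deriv V (dE p x y i j) * g j / dE p x y i j := by
    symm
    apply Finset.sum_filter_of_ne
    intro j _ hne
    by_contra hlt
    apply hne
    rw [deriv_zero_far lam V hV0 _ (not_le.1 hlt)]
    simp
  rw [h1]
  refine (Finset.abs_sum_le_sum_abs _ _).trans ?_
  refine (Finset.sum_le_card_nsmul _ _ (c * B) ?_).trans ?_
  · intro j hj
    rw [Finset.mem_filter, Finset.mem_erase] at hj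
    have hpos : 0 < dE p x y i j := hL.trans (hd i j (Ne.symm hj.1.1))
    rw [abs_div, abs_mul, abs_of_pos hpos, div_le_iff₀ hpos]
    calc _ ≤ B * (c * dE p x y i j) :=
          mul_le_mul (hVB j (Ne.symm hj.1.1) hj.2) (hg j) (abs_nonneg _) hB
      _ = _ := by ring
  · rw [nsmul_eq_mul]
    exact mul_le_mul_of_nonneg_right (by exact_mod_cast hcard) (mul_nonneg hc hB)

lemma H_bounds {n : ℕ} (a L p vmax vstar φ A : ℝ) (hA : 0 < A)
    (hφ : φ ∈ Set.Ioo 0 (Real.pi/2))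
    (V U : ℝ → ℝ) (hVnonneg : ∀ d, L < d → 0 ≤ V d)
    (hUnonneg : ∀ z ∈ Set.Ioo (-a) a, 0 ≤ U z)
    (x y θ v : Fin n → ℝ) (hw : inOmega a L p vmax φ x y θ v) (i : Fin n) :
    0 ≤ Hfun p vstar φ A U V x y θ v ∧
    U (y i) ≤ Hfun p vstar φ A U V x y θ v ∧
    (∀ j, i ≠ j → V (dE p x y i j) ≤ Hfun p vstar φ A U V x y θ v) ∧
    A * (1/(Real.cos (θ i) - Real.cos φ) - 1/(1 - Real.cos φ))
      ≤ Hfun p vstar φ A U V x y θ v ∧ Real.cos φ < Real.cos (θ i) := by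
  classical
  obtain ⟨hy, hθ, hv, hd⟩ := hw
  have hpi := Real.pi_pos
  have hcos : ∀ k, Real.cos φ < Real.cos (θ k) := by
    intro k
    rw [← Real.cos_abs (θ k)]
    exact Real.cos_lt_cos_of_nonneg_of_le_pi (abs_nonneg _) (by linarith [hφ.2])
      (abs_lt.2 (hθ k))
  have hT : ∀ k ∈ Finset.univ,
      0 ≤ 1/(Real.cos (θ k) - Real.cos φ) - 1/(1 - Real.cos φ) := by
    intro k _
    rw [sub_nonneg]
    exact one_div_le_one_div_of_le (by linarith [hcos k]) (by linarith [Real.cos_le_one (θ k)])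
  have hUk : ∀ k ∈ Finset.univ, 0 ≤ U (y k) := fun k _ => hUnonneg _ (hy k)
  have hVk : ∀ k, ∀ j ∈ Finset.univ.erase k, 0 ≤ V (dE p x y k j) := fun k j hj =>
    hVnonneg _ (hd k j (Ne.symm (Finset.mem_erase.1 hj).1))
  have hVk2 : ∀ k ∈ Finset.univ, 0 ≤ ∑ j ∈ Finset.univ.erase k, V (dE p x y k j) :=
    fun k _ => Finset.sum_nonneg (hVk k)
  have e1 : 0 ≤ (1/2 : ℝ) * ∑ i, (v i * Real.cos (θ i) - vstar)^2 := by positivity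
  have e2 : 0 ≤ (1/2 : ℝ) * ∑ i, (v i)^2 * (Real.sin (θ i))^2 := by positivity
  have e3 := Finset.sum_nonneg hUk
  have e4 := Finset.sum_nonneg hVk2
  have e5 := mul_nonneg hA.le (Finset.sum_nonneg hT)
  unfold Hfun
  refine ⟨by linarith, ?_, ?_, ?_, hcos i⟩
  · have := Finset.single_le_sum hUk (Finset.mem_univ i)
    linarith
  · intro j hij
    have hsub : ∑ k ∈ ({i, j} : Finset (Fin n)), ∑ l ∈ Finset.univ.erase k, V (dE p x y k l)
        ≤ ∑ k, ∑ l ∈ Finset.univ.erase k, V (dE p x y k l) :=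
      Finset.sum_le_sum_of_subset_of_nonneg (Finset.subset_univ _) (fun k hk _ => hVk2 k (Finset.mem_univ k))
    rw [Finset.sum_pair hij] at hsub
    have s1 := Finset.single_le_sum (hVk i) (Finset.mem_erase.2 ⟨hij.symm, Finset.mem_univ j⟩)
    have s2 := Finset.single_le_sum (hVk j) (Finset.mem_erase.2 ⟨hij, Finset.mem_univ i⟩)
    have hsym : dE p x y j i = dE p x y i j := by
      unfold dE; congr 1; ring
    rw [hsym] at s2
    linarith
  · have := mul_le_mul_of_nonneg_left (Finset.single_le_sum hT (Finset.mem_univ i)) hA.le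
    linarith

lemma coeff_bound (vmax vstar A C c s : ℝ) (hA : 0 < A) (hvs : 0 < vstar) (hlt : vstar < vmax)
    (hC0 : 0 < C) (hC : C < c) (hc : c ≤ 1) (hCv : vstar ≤ vmax * C) (hs : 0 ≤ s)
    (h : A * (1/(c - C) - 1/(1 - C)) ≤ s) :
    vmax * c / (vstar * (vmax * c - vstar)) ≤
      vmax * (A + s * C * (1 - C)) /
        (A * vstar * (vmax - vstar) + vstar * (vmax * C - vstar) * (1 - C) * s) := by
  have h1 : 0 < c - C := by linarith
  have h2 : 0 < 1 - C := by linarith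
  have hvm : 0 < vmax := by linarith
  have h3 : vstar < vmax * c := lt_of_le_of_lt hCv (mul_lt_mul_of_pos_left hC hvm)
  have key : A + s * C * (1 - C) ≤ c * (A + s * (1 - C)) := by
    have h4 : A * ((1 - C) - (c - C)) ≤ s * ((c - C) * (1 - C)) := by
      have := mul_le_mul_of_nonneg_right h (mul_pos h1 h2).le
      calc _ = A * (1/(c - C) - 1/(1 - C)) * ((c - C) * (1 - C)) := by field_simp
        _ ≤ _ := this
    nlinarith
  have hD : 0 < A * vstar * (vmax - vstar) + vstar * (vmax * C - vstar) * (1 - C) * s := by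
    have : 0 < A * vstar * (vmax - vstar) := by
      have : 0 < vmax - vstar := by linarith
      positivity
    have : 0 ≤ vstar * (vmax * C - vstar) * (1 - C) * s := by
      have : 0 ≤ vmax * C - vstar := by linarith
      positivity
    linarith
  rw [div_le_div_iff₀ (mul_pos hvs (by linarith)) hD]
  have h5 : 0 ≤ vmax * vstar * vstar * (c * (A + s * (1 - C)) - (A + s * C * (1 - C))) := by
    have : 0 ≤ c * (A + s * (1 - C)) - (A + s * C * (1 - C)) := by linarith
    positivity
  nlinarith

set_option maxHeartbeats 1000000 in
theorem stmt19 {n : ℕ} (hn : 2 ≤ n) (a L lam p vmax vstar φ A μ₁ μ₂ : ℝ)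
    (ha : 0 < a) (hL : 0 < L) (hlam : L < lam) (hp : 1 ≤ p)
    (hvmax : 0 < vmax) (hvstar : vstar ∈ Set.Ioo 0 vmax)
    (hφ : φ ∈ Set.Ioo 0 (Real.pi/2)) (hφv : vstar / vmax ≤ Real.cos φ) (hA : 0 < A)
    (hμ₁ : 0 < μ₁) (hμ₂ : 0 < μ₂)
    (f V U : ℝ → ℝ) (hf : ContDiff ℝ 1 f) (hfmax : ∀ z, max z 0 ≤ f z)
    (hV : ContDiffOn ℝ 2 V (Set.Ioi L))
    (hVlim : Filter.Tendsto V (nhdsWithin L (Set.Ioi L)) Filter.atTop)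
    (hV0 : ∀ d, lam ≤ d → V d = 0) (hVnonneg : ∀ d, L < d → 0 ≤ V d)
    (hU : ContDiffOn ℝ 2 U (Set.Ioo (-a) a))
    (hUlim1 : Filter.Tendsto U (nhdsWithin (-a) (Set.Ioi (-a))) Filter.atTop)
    (hUlim2 : Filter.Tendsto U (nhdsWithin a (Set.Iio a)) Filter.atTop)
    (hU0 : U 0 = 0) (hUnonneg : ∀ z ∈ Set.Ioo (-a) a, 0 ≤ U z)
    (m : ℕ) (hm : 2 ≤ m)
    (hmmax : IsGreatest {k : ℕ | ∃ S : Finset (ℝ × ℝ), S.card = k ∧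
      (∀ z ∈ S, L ≤ Real.sqrt (z.1^2 + p * z.2^2) ∧
        Real.sqrt (z.1^2 + p * z.2^2) ≤ lam) ∧
      (∀ z ∈ S, ∀ z' ∈ S, z ≠ z' →
        L ≤ Real.sqrt ((z.1 - z'.1)^2 + p * (z.2 - z'.2)^2))} m) :
    ∃ κ ρ : ℝ → ℝ,
      MonotoneOn κ (Set.Ici 0) ∧ (∀ s, 0 ≤ s → κ s ∈ Set.Ico 0 a) ∧
      AntitoneOn ρ (Set.Ici 0) ∧ (∀ s, 0 ≤ s → ρ s ∈ Set.Ioc L lam) ∧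
      ∀ (x y θ v : Fin n → ℝ), inOmega a L p vmax φ x y θ v → ∀ i,
        (Sx p V x y i ≤ kGain p vmax vstar μ₂ f V x y θ i * vstar ∧
          -(kGain p vmax vstar μ₂ f V x y θ i * (vmax * Real.cos (θ i) - vstar))
            ≤ Sx p V x y i) ∧
        (μ₂ ≤ kGain p vmax vstar μ₂ f V x y θ i ∧
          kGain p vmax vstar μ₂ f V x y θ i
            ≤ Rfun lam vmax vstar φ A μ₂ m f V ρ (Hfun p vstar φ A U V x y θ v)) ∧
        (Fctrl p vmax vstar μ₂ f V x y θ v i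
            ≤ kGain p vmax vstar μ₂ f V x y θ i * (vmax - v i) ∧
          kGain p vmax vstar μ₂ f V x y θ i * (vmax - v i)
            ≤ kGain p vmax vstar μ₂ f V x y θ i * vmax ∧
          -(kGain p vmax vstar μ₂ f V x y θ i * v i)
            ≤ Fctrl p vmax vstar μ₂ f V x y θ v i ∧
          -(kGain p vmax vstar μ₂ f V x y θ i * vmax)
            ≤ -(kGain p vmax vstar μ₂ f V x y θ i * v i)) ∧
        |uctrl p vmax vstar φ A μ₁ μ₂ f U V x y θ v i|
          ≤ (1/vstar) * ((μ₁ + kGain p vmax vstar μ₂ f V x y θ i) * vmax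
              + b2 U (κ (Hfun p vstar φ A U V x y θ v))
              + m * Real.sqrt p * b1 lam V (ρ (Hfun p vstar φ A U V x y θ v))) := by
  obtain ⟨κ, hκm, hκr, hκ⟩ := exists_kappa a ha U hUlim1 hUlim2 hU0
  obtain ⟨ρ, hρm, hρr, hρ⟩ := exists_rho L lam hlam V hVlim hV0
  refine ⟨κ, ρ, hκm, hκr, hρm, hρr, ?_⟩
  intro x y θ v hw i
  obtain ⟨hH0, hHU, hHV, hHA, hcos⟩ :=
    H_bounds a L p vmax vstar φ A hA hφ V U hVnonneg hUnonneg x y θ v hw i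
  obtain ⟨hy, hθ, hv, hd⟩ := hw
  have hcard := card_nbr L lam p hL m hmmax x y hd i
  set s := Hfun p vstar φ A U V x y θ v with hs
  obtain ⟨hρ1, hρ2⟩ := hρr s hH0
  have hB := b1_nonneg lam V (ρ s)
  set B := b1 lam V (ρ s) with hBdef
  have hVB : ∀ j, i ≠ j → dE p x y i j ≤ lam → |deriv V (dE p x y i j)| ≤ B :=
    fun j hij hj => le_b1 L lam V hV _ _ hρ1 ⟨hρ s _ (hd i j hij) hj (hHV j hij), hj⟩
  have hSx : |Sx p V x y i| ≤ m * B := by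
    have := sum_bound L lam p hL m V hV0 x y hd i hcard B 1 hB zero_le_one hVB
      (fun j => x i - x j) (fun j => by
        rw [one_mul]
        unfold dE
        apply Real.abs_le_sqrt
        have : 0 ≤ p * (y i - y j)^2 := by positivity
        linarith)
    rw [one_mul] at this
    exact this
  have hsp : 0 < Real.sqrt p := Real.sqrt_pos.2 (by linarith)
  have hspp : Real.sqrt p * Real.sqrt p = p := Real.mul_self_sqrt (by linarith)
  have hSy : |p * Sy p V x y i| ≤ m * Real.sqrt p * B := by
    have := sum_bound L lam p hL m V hV0 x y hd i hcard B (1 / Real.sqrt p) hB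
      (by positivity) hVB (fun j => y i - y j) (fun j => by
        rw [one_div, ← div_eq_inv_mul, le_div_iff₀ hsp]
        unfold dE
        rw [← abs_of_pos hsp, ← abs_mul]
        apply Real.abs_le_sqrt
        have h1 : ((y i - y j) * Real.sqrt p)^2 = p * (y i - y j)^2 := by
          rw [mul_pow, pow_two (Real.sqrt p), hspp]; ring
        rw [h1]
        have := sq_nonneg (x i - x j)
        linarith)
    have h2 : |Sy p V x y i| ≤ m * (1 / Real.sqrt p * B) := this
    rw [abs_mul, abs_of_pos (by linarith : 0 < p)]
    calc p * |Sy p V x y i| ≤ p * (m * (1 / Real.sqrt p * B)) :=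
          mul_le_mul_of_nonneg_left h2 (by linarith)
      _ = (Real.sqrt p * Real.sqrt p) * (m * (1 / Real.sqrt p * B)) := by rw [hspp]
      _ = _ := by field_simp
  obtain ⟨hvs, hvlt⟩ := hvstar
  have hC0 : 0 < Real.cos φ := Real.cos_pos_of_mem_Ioo ⟨by linarith [hφ.1, Real.pi_pos], hφ.2⟩
  have hCv : vstar ≤ vmax * Real.cos φ := by
    rw [div_le_iff₀ hvmax] at hφv; linarith
  have hc1 := Real.cos_le_one (θ i)
  have hc0 : 0 < Real.cos (θ i) := hC0.trans hcos
  have hcoef := coeff_bound vmax vstar A (Real.cos φ) (Real.cos (θ i)) s hA hvs hvlt hC0 hcos hc1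
    hCv hH0 hHA
  have hfS := hfmax (-(Sx p V x y i))
  have hf1 : -(Sx p V x y i) ≤ f (-(Sx p V x y i)) := (le_max_left _ _).trans hfS
  have hf0 : 0 ≤ f (-(Sx p V x y i)) := (le_max_right _ _).trans hfS
  have hfle : f (-(Sx p V x y i)) ≤ sSup (f '' Set.Icc (-(m * B)) (m * B)) := by
    apply le_csSup
    · exact (isCompact_Icc.image_of_continuousOn hf.continuous.continuousOn).bddAbove
    · refine ⟨_, ?_, rfl⟩
      have := abs_le.1 hSx
      exact ⟨by linarith [this.2], by linarith [this.1]⟩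
  set S := Sx p V x y i with hS
  set c := Real.cos (θ i) with hc
  set M := sSup (f '' Set.Icc (-(m * B)) (m * B)) with hM
  have hD : 0 < vmax * c - vstar := by
    have := mul_lt_mul_of_pos_left hcos hvmax
    linarith
  have hkdef : kGain p vmax vstar μ₂ f V x y θ i
      = μ₂ + (1/vstar) * S + (vmax * c) / (vstar * (vmax * c - vstar)) * f (-S) := rfl
  have hFdef : Fctrl p vmax vstar μ₂ f V x y θ v i
      = -(kGain p vmax vstar μ₂ f V x y θ i / c) * (v i * c - vstar) - (1 / c) * S := rfl
  set k := kGain p vmax vstar μ₂ f V x y θ i with hk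
  set F := Fctrl p vmax vstar μ₂ f V x y θ v i with hF
  have hk1 : S ≤ k * vstar := by
    have e : k * vstar = μ₂ * vstar + S + vmax * c / (vmax * c - vstar) * f (-S) := by
      rw [hkdef]; field_simp
    have : 0 ≤ vmax * c / (vmax * c - vstar) * f (-S) := by positivity
    have : 0 < μ₂ * vstar := by positivity
    linarith
  have hk2 : -(k * (vmax * c - vstar)) ≤ S := by
    have e : S + k * (vmax * c - vstar)
        = μ₂ * (vmax * c - vstar) + vmax * c / vstar * (S + f (-S)) := by
      rw [hkdef]; field_simp; ring
    have : 0 ≤ vmax * c / vstar * (S + f (-S)) :=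
      mul_nonneg (by positivity) (by linarith)
    have : 0 < μ₂ * (vmax * c - vstar) := by positivity
    linarith
  have hkμ : μ₂ ≤ k := by
    have e : k = μ₂ + (1/vstar) * (S + f (-S)) + 1 / (vmax * c - vstar) * f (-S) := by
      rw [hkdef]; field_simp; ring
    have : 0 ≤ (1/vstar) * (S + f (-S)) := mul_nonneg (by positivity) (by linarith)
    have : 0 ≤ 1 / (vmax * c - vstar) * f (-S) := by positivity
    linarith
  have hk0 : 0 < k := by linarith
  obtain ⟨hv0, hv1⟩ := hv i
  have hFc : F * c = -k * (v i * c - vstar) - S := by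
    rw [hFdef]; field_simp
  have hF1 : F ≤ k * (vmax - v i) := by
    refine le_of_mul_le_mul_right ?_ hc0
    rw [hFc]; linarith
  have hF2 : -(k * v i) ≤ F := by
    refine le_of_mul_le_mul_right ?_ hc0
    rw [hFc]; linarith
  have hkv : k * v i ≤ k * vmax := mul_le_mul_of_nonneg_left hv1.le hk0.le
  have hkv0 : 0 ≤ k * v i := by positivity
  have hF3 : k * (vmax - v i) ≤ k * vmax := by linarith
  refine ⟨⟨hk1, hk2⟩, ⟨hkμ, ?_⟩, ⟨hF1, hF3, hF2, by linarith⟩, ?_⟩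
  · rw [hkdef]
    unfold Rfun
    rw [← hBdef, ← hM]
    have t1 : (1/vstar) * S ≤ (m / vstar) * B := by
      have := mul_le_mul_of_nonneg_left ((le_abs_self S).trans hSx) (one_div_pos.2 hvs).le
      calc _ ≤ _ := this
        _ = _ := by ring
    have t2 : (vmax * c) / (vstar * (vmax * c - vstar)) * f (-S)
        ≤ vmax * (A + s * Real.cos φ * (1 - Real.cos φ)) * M /
          (A * vstar * (vmax - vstar)
            + vstar * (vmax * Real.cos φ - vstar) * (1 - Real.cos φ) * s) := by
      have hp0 : 0 ≤ (vmax * c) / (vstar * (vmax * c - vstar)) := by positivity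
      calc _ ≤ _ := mul_le_mul hcoef hfle hf0 (hp0.trans hcoef)
        _ = _ := by ring
    linarith
  · have hUb : |deriv U (y i)| ≤ b2 U (κ s) :=
      le_b2 a U hU _ _ (hκr s hH0).2 (abs_le.1 (hκ s _ (hy i) hHU))
    have hFa : |F| ≤ k * vmax := abs_le.2 ⟨by linarith, by linarith⟩
    have hsin := Real.abs_sin_le_one (θ i)
    have h1 : |μ₁ * v i * Real.sin (θ i)| ≤ μ₁ * vmax := by
      rw [abs_mul, abs_of_pos (by positivity : 0 < μ₁ * v i)]
      calc _ ≤ μ₁ * v i * 1 := mul_le_mul_of_nonneg_left hsin (by positivity)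
        _ = μ₁ * v i := mul_one _
        _ ≤ _ := mul_le_mul_of_nonneg_left hv1.le hμ₁.le
    have h2 : |Real.sin (θ i) * F| ≤ k * vmax := by
      rw [abs_mul]
      calc _ ≤ 1 * |F| := mul_le_mul_of_nonneg_right hsin (abs_nonneg _)
        _ ≤ _ := by linarith
    have h3 : |μ₁ * v i * Real.sin (θ i) + deriv U (y i) + p * Sy p V x y i
        + Real.sin (θ i) * F| ≤ (μ₁ + k) * vmax + b2 U (κ s) + m * Real.sqrt p * B := by
      have g1 := abs_le.1 h1
      have g2 := abs_le.1 h2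
      have g3 := abs_le.1 hUb
      have g4 := abs_le.1 hSy
      rw [abs_le]
      constructor <;> linarith only [g1.1, g1.2, g2.1, g2.2, g3.1, g3.2, g4.1, g4.2]
    have hq : 0 ≤ A / (v i * (c - Real.cos φ)^2) := by positivity
    have h4 : |-(vstar + A / (v i * (c - Real.cos φ)^2))⁻¹| ≤ 1 / vstar := by
      rw [abs_neg, abs_of_pos (by positivity), one_div]
      exact inv_anti₀ hvs (by linarith)
    unfold uctrl
    rw [abs_mul]
    exact mul_le_mul h4 h3 (abs_nonneg _) (by positivity)
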